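/- arXiv:2012.12572 — 2 statements merged into one kernel-verified Lean document; each statement's English description precedes it below -/
import Mathlib

section
/- Let d ≥ 1 and λ ≥ 1. Suppose Φ ∈ C^{d+2}(ℝ^d) is real-valued, ψ ∈ C^{d+1} is supported in the unit ball B(0,1) ⊂ ℝ^d, the map x ↦ ∇Φ(x) is injective on B(0,1), and L*(Φ) > 0. Then there is a constant C_d depending only on d such that |∫_{ℝ^d} e^{iλΦ(x)} ψ(x) dx| ≤ (C_d / L*(Φ)) · (1 + 𝒫_{d+2}^{d/2}) · 𝒜_{d+1} · λ^{-d/2}. -/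
open MeasureTheory Metric Set

noncomputable section

/-- Euclidean space `ℝ^d`. -/
abbrev Euc (d : ℕ) : Type := EuclideanSpace ℝ (Fin d)

/-- Supremum over `s` of the norm of the `i`-th iterated (Fréchet) derivative of `f`. -/
noncomputable def supDeriv {d : ℕ} {F : Type*} [NormedAddCommGroup F] [NormedSpace ℝ F]
    (i : ℕ) (f : Euc d → F) (s : Set (Euc d)) : ℝ :=
  sSup ((fun x => ‖iteratedFDeriv ℝ i f x‖) '' s)

/-- The `C^k` norm of `f` on the set `s` (`k` a natural number):
sum of the sup-norms of all derivatives of order up to `k`. -/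
noncomputable def CnormNat {d : ℕ} {F : Type*} [NormedAddCommGroup F] [NormedSpace ℝ F]
    (k : ℕ) (f : Euc d → F) (s : Set (Euc d)) : ℝ :=
  ∑ j ∈ Finset.range (k + 1), supDeriv j f s

/-- The quantity `𝒫_r` (integer `r`): sizes of all derivatives of `Φ` of orders `2,…,r` on `s`. -/
noncomputable def Pnorm {d : ℕ} (r : ℕ) (Φ : Euc d → ℝ) (s : Set (Euc d)) : ℝ :=
  ∑ j ∈ Finset.Icc 2 r, supDeriv j Φ s

/-- The Hessian matrix of `Φ` at `x`. -/
noncomputable def Hess {d : ℕ} (Φ : Euc d → ℝ) (x : Euc d) : Matrix (Fin d) (Fin d) ℝ :=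
  Matrix.of fun i j =>
    iteratedFDeriv ℝ 2 Φ x ![EuclideanSpace.single i (1 : ℝ), EuclideanSpace.single j (1 : ℝ)]

/-- `L^*(Φ) = inf_{x ∈ s} |det HΦ(x)|`. -/
noncomputable def LStar {d : ℕ} (Φ : Euc d → ℝ) (s : Set (Euc d)) : ℝ :=
  sInf ((fun x => |(Hess Φ x).det|) '' s)

/-- The oscillatory integral `I(λ, Φ, ψ) = ∫ e^{iλΦ(x)} ψ(x) dx`. -/
noncomputable def oscInt {d : ℕ} (lam : ℝ) (Φ : Euc d → ℝ) (ψ : Euc d → ℂ) : ℂ :=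
  ∫ x : Euc d, Complex.exp (Complex.I * (lam : ℂ) * (Φ x : ℂ)) * ψ x

/-- `f` is of class `C^m`, with derivatives of order at most `m` bounded by `C * M` on `U`. -/
structure IsSymbol {E F : Type*} [NormedAddCommGroup E] [NormedSpace ℝ E]
    [NormedAddCommGroup F] [NormedSpace ℝ F]
    (U : Set E) (m : ℕ) (C : ℝ) (M : E → ℝ) (f : E → F) : Prop where
  contDiff : ContDiff ℝ m f
  bound : ∀ j ≤ m, ∀ x ∈ U, ‖iteratedFDeriv ℝ j f x‖ ≤ C * M x

namespace IsSymbol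

variable {E F : Type*} [NormedAddCommGroup E] [NormedSpace ℝ E]
  [NormedAddCommGroup F] [NormedSpace ℝ F] {U : Set E} {m : ℕ} {C C₁ C₂ : ℝ} {M M₁ M₂ : E → ℝ}

theorem mono {f : E → F} (h : IsSymbol U m C₁ M₁ f) {n : ℕ} (hn : n ≤ m)
    (hM : ∀ x ∈ U, C₁ * M₁ x ≤ C₂ * M₂ x) : IsSymbol U n C₂ M₂ f :=
  ⟨h.contDiff.of_le (by exact_mod_cast hn),
    fun j hj x hx => (h.bound j (hj.trans hn) x hx).trans (hM x hx)⟩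

theorem add {f g : E → F} (hf : IsSymbol U m C₁ M f) (hg : IsSymbol U m C₂ M g) :
    IsSymbol U m (C₁ + C₂) M (fun x => f x + g x) := by
  refine ⟨hf.contDiff.add hg.contDiff, fun j hj x hx => ?_⟩
  have hj' : (j : WithTop ℕ∞) ≤ m := by exact_mod_cast hj
  have : iteratedFDeriv ℝ j (fun x => f x + g x) x
      = iteratedFDeriv ℝ j f x + iteratedFDeriv ℝ j g x :=
    iteratedFDeriv_add_apply (hf.contDiff.of_le hj').contDiffAt (hg.contDiff.of_le hj').contDiffAt
  rw [this, add_mul]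
  exact norm_add_le_of_le (hf.bound j hj x hx) (hg.bound j hj x hx)

theorem sum {ι : Type*} (s : Finset ι) {f : ι → E → F} (hf : ∀ i ∈ s, IsSymbol U m C M (f i)) :
    IsSymbol U m (s.card * C) M (fun x => ∑ i ∈ s, f i x) := by
  refine ⟨ContDiff.sum fun i hi => (hf i hi).contDiff, fun j hj x hx => ?_⟩
  have hj' : (j : WithTop ℕ∞) ≤ m := by exact_mod_cast hj
  rw [iteratedFDeriv_sum fun i hi => (hf i hi).contDiff.of_le hj', Finset.sum_apply]
  refine (norm_sum_le _ _).trans ((Finset.sum_le_sum fun i hi => (hf i hi).bound j hj x hx).trans ?_)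
  simp [mul_assoc]

theorem smul {f : E → ℝ} {g : E → F} (hC₁ : 0 ≤ C₁) (hM₁ : ∀ x ∈ U, 0 ≤ M₁ x)
    (hf : IsSymbol U m C₁ M₁ f) (hg : IsSymbol U m C₂ M₂ g) :
    IsSymbol U m (2 ^ m * (C₁ * C₂)) (fun x => M₁ x * M₂ x) (fun x => f x • g x) := by
  refine ⟨hf.contDiff.smul hg.contDiff, fun j hj x hx => ?_⟩
  have hj' : (j : WithTop ℕ∞) ≤ m := by exact_mod_cast hj
  have h0 : 0 ≤ C₁ * M₁ x := mul_nonneg hC₁ (hM₁ x hx)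
  have h0' : 0 ≤ C₂ * M₂ x := (norm_nonneg _).trans (hg.bound j hj x hx)
  calc ‖iteratedFDeriv ℝ j (fun x => f x • g x) x‖
      ≤ ∑ i ∈ Finset.range (j + 1), (j.choose i : ℝ) * ‖iteratedFDeriv ℝ i f x‖
          * ‖iteratedFDeriv ℝ (j - i) g x‖ :=
        norm_iteratedFDeriv_smul_le hf.contDiff hg.contDiff x hj'
    _ ≤ ∑ i ∈ Finset.range (j + 1), (j.choose i : ℝ) * (C₁ * M₁ x) * (C₂ * M₂ x) := by
        refine Finset.sum_le_sum fun i hi => ?_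
        have hi : i ≤ j := Nat.lt_succ_iff.mp (Finset.mem_range.mp hi)
        gcongr
        · exact hf.bound i (hi.trans hj) x hx
        · exact hg.bound (j - i) ((Nat.sub_le j i).trans hj) x hx
    _ = 2 ^ j * ((C₁ * M₁ x) * (C₂ * M₂ x)) := by
        have : ∑ i ∈ Finset.range (j + 1), (j.choose i : ℝ) = 2 ^ j := by
          exact_mod_cast Nat.sum_range_choose j
        rw [← this, Finset.sum_mul]
        exact Finset.sum_congr rfl fun i _ => by ring
    _ ≤ 2 ^ m * ((C₁ * M₁ x) * (C₂ * M₂ x)) := by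
        gcongr
        norm_num
    _ = _ := by ring

theorem inv {w : E → ℝ} (hC : 1 ≤ C) (hw : ∀ x, 0 < w x) (h : IsSymbol U m C w w) :
    IsSymbol U m (m.factorial ^ 2 * C ^ m) (fun x => (w x)⁻¹) (fun x => (w x)⁻¹) := by
  refine ⟨h.contDiff.inv fun x => (hw x).ne', fun j hj x₀ hx => ?_⟩
  have hj' : (j : WithTop ℕ∞) ≤ m := by exact_mod_cast hj
  set c := (w x₀)⁻¹ with hc
  have hc0 : 0 < c := inv_pos.mpr (hw x₀)
  have hcomp : (fun x => (w x)⁻¹) = c • ((fun t : ℝ => t⁻¹) ∘ (c • w)) := by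
    funext x
    simp only [Pi.smul_apply, Function.comp, smul_eq_mul, mul_inv]
    rw [mul_inv_cancel_left₀ hc0.ne']
  have hcw : ContDiff ℝ m (c • w) := contDiff_const.smul h.contDiff
  have hinv : ContDiffOn ℝ m (fun t : ℝ => t⁻¹) (Ioi 0) :=
    contDiffOn_id.inv fun t ht => (ne_of_gt ht)
  have hfc : ContDiff ℝ m ((fun t : ℝ => t⁻¹) ∘ (c • w)) :=
    hcw.inv fun x => (mul_pos hc0 (hw x)).ne'
  have key := norm_iteratedFDerivWithin_comp_le (s := univ) (x := x₀) (n := j) hinv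
    hcw.contDiffOn hj' (uniqueDiffOn_Ioi 0) uniqueDiffOn_univ
    (fun x _ => mul_pos hc0 (hw x)) (mem_univ _) (C := m.factorial) (D := C) ?_ ?_
  · rw [iteratedFDerivWithin_univ] at key
    rw [hcomp, iteratedFDeriv_const_smul_apply (hfc.of_le hj').contDiffAt, norm_smul,
      Real.norm_of_nonneg hc0.le, mul_comm]
    change _ ≤ _ * c
    gcongr
    refine key.trans ?_
    rw [sq]
    gcongr
  · intro i hi
    have h1 : (c • w) x₀ = 1 := inv_mul_cancel₀ (hw x₀).ne'
    rw [h1, iteratedFDerivWithin_of_isOpen i isOpen_Ioi (by norm_num : (1 : ℝ) ∈ Ioi (0 : ℝ)),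
      norm_iteratedFDeriv_eq_norm_iteratedDeriv, iteratedDeriv_eq_iterate]
    have := iter_deriv_inv i (1 : ℝ)
    rw [show (fun t : ℝ => t⁻¹) = Inv.inv from rfl, this]
    simp only [one_zpow, mul_one, norm_mul, norm_pow, norm_neg, norm_one, one_pow, one_mul]
    rw [Real.norm_of_nonneg (by positivity)]
    exact_mod_cast Nat.factorial_le (hi.trans hj)
  · intro i hi hij
    have hi' : (i : WithTop ℕ∞) ≤ m := by exact_mod_cast hij.trans hj
    rw [iteratedFDerivWithin_univ, iteratedFDeriv_const_smul_apply
      (h.contDiff.of_le hi').contDiffAt, norm_smul, Real.norm_of_nonneg hc0.le]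
    calc c * ‖iteratedFDeriv ℝ i w x₀‖ ≤ c * (C * w x₀) := by
          gcongr; exact h.bound i (hij.trans hj) x₀ hx
      _ = C := by rw [hc]; field_simp [(hw x₀).ne']
      _ ≤ C ^ i := le_self_pow₀ hC (by omega)

theorem fderiv_apply {f : E → F} (hf : IsSymbol U (m + 1) C M f) {v : E} (hv : ‖v‖ ≤ 1) :
    IsSymbol U m C M (fun x => fderiv ℝ f x v) := by
  have hd : ContDiff ℝ m (fderiv ℝ f) := hf.contDiff.fderiv_right (by norm_cast)
  refine ⟨hd.clm_apply contDiff_const, fun j hj x hx => ?_⟩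
  refine (norm_iteratedFDeriv_clm_apply_const hd.contDiffAt (by exact_mod_cast hj)).trans ?_
  rw [norm_iteratedFDeriv_fderiv]
  exact (mul_le_of_le_one_left (norm_nonneg _) hv).trans (hf.bound (j + 1) (by omega) x hx)

end IsSymbol

section Transpose

variable {d : ℕ}

/-- The partial derivative `∂ⱼ f`. -/
def partialDeriv {F : Type*} [NormedAddCommGroup F] [NormedSpace ℝ F] (j : Fin d) (f : Euc d → F)
    (x : Euc d) : F :=
  fderiv ℝ f x (EuclideanSpace.single j 1)

/-- The weight `1 + |∇Φ|²`. -/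
def gradWeight (Φ : Euc d → ℝ) (x : Euc d) : ℝ := 1 + ∑ j, partialDeriv j Φ x * partialDeriv j Φ x

/-- The transpose of `(1 + |∇Φ|²)⁻¹ (1 - i ∇Φ · ∇)`, an operator that fixes `e^{iΦ}`. -/
def transposeOp (Φ : Euc d → ℝ) (f : Euc d → ℂ) (x : Euc d) : ℂ :=
  (gradWeight Φ x)⁻¹ • f x +
    ∑ j, Complex.I * partialDeriv j (fun y => (partialDeriv j Φ y * (gradWeight Φ y)⁻¹) • f y) x

theorem gradWeight_pos (Φ : Euc d → ℝ) (x : Euc d) : 0 < gradWeight Φ x :=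
  add_pos_of_pos_of_nonneg one_pos (Finset.sum_nonneg fun _ _ => mul_self_nonneg _)

theorem one_le_gradWeight (Φ : Euc d → ℝ) (x : Euc d) : 1 ≤ gradWeight Φ x :=
  le_add_of_nonneg_right (Finset.sum_nonneg fun _ _ => mul_self_nonneg _)

theorem gradient_apply {Φ : Euc d → ℝ} (x : Euc d) (j : Fin d) :
    gradient Φ x j = partialDeriv j Φ x := by
  have h : inner ℝ (gradient Φ x) (EuclideanSpace.single j (1 : ℝ)) = partialDeriv j Φ x := by
    simp [gradient, partialDeriv]
  rw [← h, EuclideanSpace.inner_single_right]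
  simp

theorem gradWeight_eq (Φ : Euc d → ℝ) (x : Euc d) : gradWeight Φ x = 1 + ‖gradient Φ x‖ ^ 2 := by
  rw [EuclideanSpace.norm_sq_eq, gradWeight]
  simp [gradient_apply, sq]

theorem contDiff_partialDeriv {F : Type*} [NormedAddCommGroup F] [NormedSpace ℝ F] {m : ℕ}
    {f : Euc d → F} (hf : ContDiff ℝ (m + 1 : ℕ) f) (j : Fin d) :
    ContDiff ℝ m (partialDeriv j f) :=
  (hf.fderiv_right (m := m) (by norm_cast)).clm_apply contDiff_const

theorem contDiff_gradWeight {m : ℕ} {Φ : Euc d → ℝ} (hΦ : ContDiff ℝ (m + 1 : ℕ) Φ) :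
    ContDiff ℝ m (gradWeight Φ) :=
  contDiff_const.add (ContDiff.sum fun j _ =>
    (contDiff_partialDeriv hΦ j).mul (contDiff_partialDeriv hΦ j))

theorem contDiff_gradWeight_inv {m : ℕ} {Φ : Euc d → ℝ} (hΦ : ContDiff ℝ (m + 1 : ℕ) Φ) :
    ContDiff ℝ m (fun x => (gradWeight Φ x)⁻¹) :=
  (contDiff_gradWeight hΦ).inv fun x => (gradWeight_pos Φ x).ne'

theorem tsupport_partialDeriv_subset {F : Type*} [NormedAddCommGroup F] [NormedSpace ℝ F]
    (j : Fin d) (f : Euc d → F) : tsupport (partialDeriv j f) ⊆ tsupport f := by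
  refine (closure_mono fun x hx => ?_).trans (tsupport_fderiv_subset ℝ (f := f))
  intro h
  exact hx (by simp [partialDeriv, h])

theorem tsupport_transposeOp_subset (Φ : Euc d → ℝ) (f : Euc d → ℂ) :
    tsupport (transposeOp Φ f) ⊆ tsupport f := by
  refine closure_minimal (fun x hx => ?_) (isClosed_tsupport f)
  by_contra hxf
  refine hx ?_
  have h2 : ∀ j, partialDeriv j
      (fun y => (partialDeriv j Φ y * (gradWeight Φ y)⁻¹) • f y) x = 0 := fun j =>
    image_eq_zero_of_notMem_tsupport fun h =>
      hxf (tsupport_smul_subset_right _ f (tsupport_partialDeriv_subset j _ h))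
  simp only [transposeOp, h2, image_eq_zero_of_notMem_tsupport hxf, smul_zero, mul_zero,
    Finset.sum_const_zero, add_zero]

theorem integrable_mul_of_hasCompactSupport {e f : Euc d → ℂ} (he : Continuous e)
    (hf : Continuous f) (hs : HasCompactSupport f) : Integrable fun x => e x * f x :=
  (he.mul hf).integrable_of_hasCompactSupport hs.mul_left

theorem hasCompactSupport_partialDeriv {f : Euc d → ℂ} (hs : HasCompactSupport f) (j : Fin d) :
    HasCompactSupport (partialDeriv j f) :=
  hs.of_isClosed_subset (isClosed_tsupport _) (tsupport_partialDeriv_subset j f)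

theorem integral_mul_partialDeriv {e f : Euc d → ℂ} (he : ContDiff ℝ (1 : ℕ) e)
    (hf : ContDiff ℝ (1 : ℕ) f) (hs : HasCompactSupport f) (j : Fin d) :
    ∫ x, e x * partialDeriv j f x = -∫ x, partialDeriv j e x * f x :=
  integral_mul_fderiv_eq_neg_fderiv_mul_of_integrable
    (integrable_mul_of_hasCompactSupport (contDiff_partialDeriv (m := 0) he j).continuous
      hf.continuous hs)
    (integrable_mul_of_hasCompactSupport he.continuous
      (contDiff_partialDeriv (m := 0) hf j).continuous (hasCompactSupport_partialDeriv hs j))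
    (integrable_mul_of_hasCompactSupport he.continuous hf.continuous hs)
    (fun x _ => (he.differentiable (by norm_num)).differentiableAt)
    (fun x _ => (hf.differentiable (by norm_num)).differentiableAt)

theorem partialDeriv_cexp {Φ : Euc d → ℝ} (hΦ : Differentiable ℝ Φ) (j : Fin d) (x : Euc d) :
    partialDeriv j (fun x => Complex.exp (Complex.I * Φ x)) x
      = Complex.I * (partialDeriv j Φ x : ℝ) * Complex.exp (Complex.I * Φ x) := by
  have h1 : HasFDerivAt (fun x => (Φ x : ℂ)) (Complex.ofRealCLM.comp (fderiv ℝ Φ x)) x :=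
    Complex.ofRealCLM.hasFDerivAt.comp x hΦ.differentiableAt.hasFDerivAt
  have h2 := ((h1.const_mul Complex.I).cexp).fderiv
  rw [partialDeriv, h2]
  simp [partialDeriv]
  ring

theorem contDiff_cexp_phase {m : ℕ} {Φ : Euc d → ℝ} (hΦ : ContDiff ℝ m Φ) :
    ContDiff ℝ m (fun x => Complex.exp (Complex.I * Φ x)) :=
  (contDiff_const.mul (Complex.ofRealCLM.contDiff.comp hΦ)).cexp

theorem phase_identity {Φ : Euc d → ℝ} (hΦ : Differentiable ℝ Φ) (z : ℂ) (x : Euc d) :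
    Complex.exp (Complex.I * Φ x) * ((gradWeight Φ x)⁻¹ • z) + ∑ j, Complex.I *
      -(partialDeriv j (fun x => Complex.exp (Complex.I * Φ x)) x *
        ((partialDeriv j Φ x * (gradWeight Φ x)⁻¹) • z)) = Complex.exp (Complex.I * Φ x) * z := by
  have hw : (gradWeight Φ x : ℂ) = 1 + ∑ j, ((partialDeriv j Φ x : ℝ) : ℂ) * (partialDeriv j Φ x : ℝ) := by
    simp [gradWeight]
  have hw0 : (gradWeight Φ x : ℂ) ≠ 0 := by exact_mod_cast (gradWeight_pos Φ x).ne'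
  simp_rw [partialDeriv_cexp hΦ, Complex.real_smul, Complex.ofReal_mul, Complex.ofReal_inv]
  generalize Complex.exp (Complex.I * Φ x) = e
  have : ∀ j, Complex.I * -(Complex.I * ((partialDeriv j Φ x : ℝ) : ℂ) * e *
      (((partialDeriv j Φ x : ℝ) : ℂ) * (gradWeight Φ x : ℂ)⁻¹ * z))
      = (((partialDeriv j Φ x : ℝ) : ℂ) * (partialDeriv j Φ x : ℝ)) * (e * ((gradWeight Φ x : ℂ)⁻¹ * z)) := by
    intro j
    linear_combination (-((partialDeriv j Φ x : ℝ) : ℂ) ^ 2 * e * ((gradWeight Φ x : ℂ)⁻¹ * z))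
      * Complex.I_sq
  simp_rw [this]
  rw [← Finset.sum_mul]
  calc _ = (1 + ∑ j, ((partialDeriv j Φ x : ℝ) : ℂ) * (partialDeriv j Φ x : ℝ)) *
        (e * ((gradWeight Φ x : ℂ)⁻¹ * z)) := by ring
    _ = _ := by rw [← hw]; field_simp

theorem hasCompactSupport_smul (b : Euc d → ℝ) {f : Euc d → ℂ} (hs : HasCompactSupport f) :
    HasCompactSupport (fun x => b x • f x) :=
  hs.of_isClosed_subset (isClosed_tsupport _) (tsupport_smul_subset_right b f)

theorem integral_transposeOp {Φ : Euc d → ℝ} {f : Euc d → ℂ} (hΦ : ContDiff ℝ (2 : ℕ) Φ)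
    (hf : ContDiff ℝ (1 : ℕ) f) (hs : HasCompactSupport f) :
    ∫ x, Complex.exp (Complex.I * Φ x) * transposeOp Φ f x
      = ∫ x, Complex.exp (Complex.I * Φ x) * f x := by
  have hΦ1 : ContDiff ℝ (1 : ℕ) Φ := hΦ.of_le (by norm_num)
  have hpt := phase_identity (hΦ1.differentiable (by norm_num))
  have heC := contDiff_cexp_phase hΦ1
  have hgC : ∀ j, ContDiff ℝ (1 : ℕ)
      (fun y => (partialDeriv j Φ y * (gradWeight Φ y)⁻¹) • f y) := fun j =>
    ((contDiff_partialDeriv hΦ j).mul (contDiff_gradWeight_inv hΦ)).smul hf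
  have hgs : ∀ j, HasCompactSupport
      (fun y => (partialDeriv j Φ y * (gradWeight Φ y)⁻¹) • f y) := fun j => hasCompactSupport_smul _ hs
  have hi4 : Integrable fun x => Complex.exp (Complex.I * Φ x) * ((gradWeight Φ x)⁻¹ • f x) :=
    integrable_mul_of_hasCompactSupport heC.continuous
    ((contDiff_gradWeight_inv (m := 0) hΦ1).continuous.smul hf.continuous) (hasCompactSupport_smul _ hs)
  have hsum : ∀ x, Complex.exp (Complex.I * Φ x) * transposeOp Φ f x
      = Complex.exp (Complex.I * Φ x) * ((gradWeight Φ x)⁻¹ • f x) +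
        ∑ j, Complex.I * (Complex.exp (Complex.I * Φ x) * partialDeriv j
          (fun y => (partialDeriv j Φ y * (gradWeight Φ y)⁻¹) • f y) x) := by
    intro x
    rw [transposeOp, mul_add, Finset.mul_sum]
    simp_rw [mul_left_comm]
  have hi1 := fun j => (integrable_mul_of_hasCompactSupport heC.continuous
    (contDiff_partialDeriv (m := 0) (hgC j) j).continuous
    (hasCompactSupport_partialDeriv (hgs j) j)).const_mul Complex.I
  have hi2 : ∀ j, Integrable fun x => Complex.I *
      -(partialDeriv j (fun x => Complex.exp (Complex.I * Φ x)) x *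
        ((partialDeriv j Φ x * (gradWeight Φ x)⁻¹) • f x)) := fun j => (integrable_mul_of_hasCompactSupport
    (contDiff_partialDeriv (m := 0) heC j).continuous (hgC j).continuous (hgs j)).neg.const_mul
      Complex.I
  simp_rw [hsum]
  rw [integral_add hi4 (integrable_finsetSum _ fun j _ => hi1 j),
    integral_finsetSum _ fun j _ => hi1 j]
  simp_rw [integral_const_mul, fun j => integral_mul_partialDeriv heC (hgC j) (hgs j) j,
    ← integral_neg, ← integral_const_mul]
  rw [← integral_finsetSum _ fun j _ => hi2 j,
    ← integral_add hi4 (integrable_finsetSum _ fun j _ => hi2 j)]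
  exact integral_congr_ae (Filter.Eventually.of_forall fun x => hpt (f x) x)

end Transpose

section SymbolEstimates

variable {d : ℕ}

theorem isSymbol_partialDeriv_phase {U : Set (Euc d)} {Φ : Euc d → ℝ} {n : ℕ}
    (hΦ : ContDiff ℝ (n + 1 : ℕ) Φ)
    (hb : ∀ j, 2 ≤ j → j ≤ n + 1 → ∀ x ∈ U, ‖iteratedFDeriv ℝ j Φ x‖ ≤ 1) (i : Fin d) :
    IsSymbol U n 1 (fun x => √(gradWeight Φ x)) (partialDeriv i Φ) := by
  refine ⟨contDiff_partialDeriv hΦ i, fun j hj x hx => ?_⟩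
  rw [one_mul]
  rcases Nat.eq_zero_or_pos j with rfl | hj0
  · rw [norm_iteratedFDeriv_zero, Real.norm_eq_abs]
    refine Real.abs_le_sqrt ?_
    rw [sq]
    have := Finset.single_le_sum (f := fun i => partialDeriv i Φ x * partialDeriv i Φ x)
      (fun i _ => mul_self_nonneg _) (Finset.mem_univ i)
    exact this.trans (le_add_of_nonneg_left zero_le_one)
  · refine le_trans ?_ (Real.one_le_sqrt.mpr (one_le_gradWeight Φ x))
    have hd : ContDiff ℝ n (fderiv ℝ Φ) := hΦ.fderiv_right (by norm_cast)
    refine (norm_iteratedFDeriv_clm_apply_const hd.contDiffAt (by exact_mod_cast hj)).trans ?_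
    rw [norm_iteratedFDeriv_fderiv, show ‖EuclideanSpace.single i (1 : ℝ)‖ = 1 by simp, one_mul]
    exact hb (j + 1) (by omega) (by omega) x hx

theorem isSymbol_gradWeight {U : Set (Euc d)} {Φ : Euc d → ℝ} {n : ℕ}
    (hΦ : ContDiff ℝ (n + 1 : ℕ) Φ)
    (hb : ∀ j, 2 ≤ j → j ≤ n + 1 → ∀ x ∈ U, ‖iteratedFDeriv ℝ j Φ x‖ ≤ 1) :
    IsSymbol U n (1 + d * 2 ^ n) (gradWeight Φ) (gradWeight Φ) := by
  have h1 : IsSymbol U n 1 (gradWeight Φ) (fun _ : Euc d => (1 : ℝ)) := by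
    refine ⟨contDiff_const, fun j _ x _ => ?_⟩
    rw [one_mul]
    refine le_trans ?_ (one_le_gradWeight Φ x)
    rcases Nat.eq_zero_or_pos j with rfl | hj0
    · simp
    · simp [iteratedFDeriv_const_of_ne hj0.ne']
  have h2 : ∀ i ∈ Finset.univ, IsSymbol U n (2 ^ n) (gradWeight Φ)
      (fun x => partialDeriv i Φ x * partialDeriv i Φ x) := fun i _ => by
    have h := isSymbol_partialDeriv_phase hΦ hb i
    refine (h.smul zero_le_one (fun x _ => Real.sqrt_nonneg _) h).mono le_rfl fun x _ => ?_
    simp [Real.mul_self_sqrt (gradWeight_pos Φ x).le]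
  have h3 := h1.add (IsSymbol.sum Finset.univ h2)
  rw [Finset.card_univ, Fintype.card_fin] at h3
  exact h3

theorem exists_isSymbol_transposeOp (d m : ℕ) :
    ∃ C : ℝ, 0 ≤ C ∧ ∀ (U : Set (Euc d)) (Φ : Euc d → ℝ), ContDiff ℝ (m + 2 : ℕ) Φ →
      (∀ j, 2 ≤ j → j ≤ m + 2 → ∀ x ∈ U, ‖iteratedFDeriv ℝ j Φ x‖ ≤ 1) →
      ∀ (k : ℕ) (A : ℝ) (f : Euc d → ℂ),
        IsSymbol U (m + 1) A (fun x => (√(gradWeight Φ x))⁻¹ ^ k) f →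
        IsSymbol U m (C * A) (fun x => (√(gradWeight Φ x))⁻¹ ^ (k + 1)) (transposeOp Φ f) := by
  set K : ℝ := (m + 1).factorial ^ 2 * (1 + d * 2 ^ (m + 1)) ^ (m + 1) with hK
  have hK0 : 0 ≤ K := by positivity
  set B : ℝ := 2 ^ (m + 1) * (1 * K) with hB
  have hB0 : 0 ≤ B := by positivity
  refine ⟨2 ^ (m + 1) * K + d * (2 ^ (m + 1) * B), by positivity, ?_⟩
  intro U Φ hΦ hb k A f hf
  have hw0 := gradWeight_pos Φ
  have hs1 : ∀ x, 1 ≤ √(gradWeight Φ x) := fun x => Real.one_le_sqrt.mpr (one_le_gradWeight Φ x)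
  have hs0 : ∀ x, 0 < √(gradWeight Φ x) := fun x => Real.sqrt_pos.mpr (hw0 x)
  have hsw : ∀ x, (gradWeight Φ x)⁻¹ = (√(gradWeight Φ x))⁻¹ ^ 2 := fun x => by
    rw [inv_pow, Real.sq_sqrt (hw0 x).le]
  have hinv : IsSymbol U (m + 1) K (fun x => (gradWeight Φ x)⁻¹) (fun x => (gradWeight Φ x)⁻¹) :=
    (isSymbol_gradWeight hΦ hb).inv (le_add_of_nonneg_right (by positivity)) hw0
  have hbs : ∀ i, IsSymbol U (m + 1) B (fun x => (√(gradWeight Φ x))⁻¹)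
      (fun x => partialDeriv i Φ x * (gradWeight Φ x)⁻¹) := fun i => by
    refine ((isSymbol_partialDeriv_phase hΦ hb i).smul zero_le_one
      (fun x _ => (hs0 x).le) hinv).mono le_rfl fun x _ => le_of_eq ?_
    rw [hsw, hB]
    field_simp [(hs0 x).ne']
  have hA : ∀ x ∈ U, 0 ≤ A := fun x hx =>
    nonneg_of_mul_nonneg_left ((norm_nonneg _).trans (hf.bound 0 (Nat.zero_le _) x hx))
      (pow_pos (inv_pos.mpr (hs0 x)) k)
  have h1 : IsSymbol U m (2 ^ (m + 1) * K * A) (fun x => (√(gradWeight Φ x))⁻¹ ^ (k + 1))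
      (fun x => (gradWeight Φ x)⁻¹ • f x) := by
    refine (hinv.smul hK0 (fun x _ => (inv_pos.mpr (hw0 x)).le) hf).mono (Nat.le_succ m)
      fun x hx => ?_
    have hA0 := hA x hx
    have : (gradWeight Φ x)⁻¹ ≤ (√(gradWeight Φ x))⁻¹ := by
      rw [hsw]
      exact pow_le_of_le_one (inv_pos.mpr (hs0 x)).le (inv_le_one_of_one_le₀ (hs1 x)) two_ne_zero
    have h0 := hs0 x
    rw [mul_assoc (2 ^ (m + 1)) K A]
    refine mul_le_mul_of_nonneg_left ?_ (by positivity)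
    rw [pow_succ']
    exact mul_le_mul_of_nonneg_right this (by positivity)
  have h2 : ∀ i, IsSymbol U m (2 ^ (m + 1) * B * A) (fun x => (√(gradWeight Φ x))⁻¹ ^ (k + 1))
      (fun x => Complex.I * partialDeriv i
        (fun y => (partialDeriv i Φ y * (gradWeight Φ y)⁻¹) • f y) x) := fun i => by
    have h := ((hbs i).smul hB0 (fun x _ => (inv_pos.mpr (hs0 x)).le) hf).fderiv_apply
      (v := EuclideanSpace.single i 1) (by simp)
    refine ⟨contDiff_const.mul h.contDiff, fun j hj x hx => ?_⟩
    have hj' : (j : WithTop ℕ∞) ≤ m := by exact_mod_cast hj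
    have h' := iteratedFDeriv_const_smul_apply (a := Complex.I)
      (h.contDiff.of_le hj').contDiffAt (x := x)
    have hn := congrArg norm h'
    rw [norm_smul, Complex.norm_I, one_mul] at hn
    refine (le_of_eq hn).trans ((h.bound j hj x hx).trans (le_of_eq ?_))
    ring
  have h3 := h1.add (IsSymbol.sum Finset.univ fun i _ => h2 i)
  refine h3.mono le_rfl fun x _ => le_of_eq ?_
  rw [Finset.card_univ, Fintype.card_fin]
  ring

theorem exists_isSymbol_iterate_transposeOp (d k : ℕ) : ∀ m : ℕ,
    ∃ C : ℝ, 0 ≤ C ∧ ∀ (U : Set (Euc d)) (Φ : Euc d → ℝ), ContDiff ℝ (m + k + 1 : ℕ) Φ →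
      (∀ j, 2 ≤ j → j ≤ m + k + 1 → ∀ x ∈ U, ‖iteratedFDeriv ℝ j Φ x‖ ≤ 1) →
      ∀ (A : ℝ) (f : Euc d → ℂ), IsSymbol U (m + k) A (fun _ => 1) f → HasCompactSupport f →
        IsSymbol U m (C * A) (fun x => (√(gradWeight Φ x))⁻¹ ^ k) ((transposeOp Φ)^[k] f) ∧
        tsupport ((transposeOp Φ)^[k] f) ⊆ tsupport f ∧
        ∫ x, Complex.exp (Complex.I * Φ x) * (transposeOp Φ)^[k] f x
          = ∫ x, Complex.exp (Complex.I * Φ x) * f x := by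
  induction k with
  | zero =>
    intro m
    refine ⟨1, zero_le_one, fun U Φ _ _ A f hf _ => ⟨?_, subset_rfl, rfl⟩⟩
    simpa using hf
  | succ k ih =>
    intro m
    obtain ⟨C₁, hC₁, h₁⟩ := ih (m + 1)
    obtain ⟨C₂, hC₂, h₂⟩ := exists_isSymbol_transposeOp d m
    refine ⟨C₂ * C₁, mul_nonneg hC₂ hC₁, fun U Φ hΦ hb A f hf hs => ?_⟩
    have he : m + (k + 1) = m + 1 + k := by omega
    rw [he] at hΦ hb hf
    obtain ⟨hsym, hsupp, hint⟩ := h₁ U Φ hΦ hb A f hf hs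
    have hcs : HasCompactSupport ((transposeOp Φ)^[k] f) :=
      hs.of_isClosed_subset (isClosed_tsupport _) hsupp
    rw [Function.iterate_succ_apply']
    refine ⟨?_, (tsupport_transposeOp_subset Φ _).trans hsupp, ?_⟩
    · rw [mul_assoc]
      refine h₂ U Φ (hΦ.of_le ?_) (fun j h2 hj => hb j h2 (by omega)) k _ _ hsym
      exact_mod_cast (by omega : m + 2 ≤ m + 1 + k + 1)
    · rw [← hint]
      refine integral_transposeOp (hΦ.of_le ?_) (hsym.contDiff.of_le ?_) hcs
      · exact_mod_cast (by omega : 2 ≤ m + 1 + k + 1)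
      · exact_mod_cast (by omega : 1 ≤ m + 1)

end SymbolEstimates

section StationaryPhase

variable {d : ℕ}

theorem differentiable_gradient {Φ : Euc d → ℝ} (hΦ : ContDiff ℝ (2 : ℕ) Φ) :
    Differentiable ℝ (gradient Φ) := fun x => by
  rw [differentiableAt_euclidean]
  intro j
  simp_rw [gradient_apply]
  exact ((contDiff_partialDeriv (m := 1) hΦ j).differentiable (by norm_num)).differentiableAt

theorem fderiv_gradient_apply {Φ : Euc d → ℝ} (hΦ : ContDiff ℝ (2 : ℕ) Φ) (x v : Euc d)
    (j : Fin d) : fderiv ℝ (gradient Φ) x v j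
      = fderiv ℝ (fderiv ℝ Φ) x v (EuclideanSpace.single j 1) := by
  have h1 : HasFDerivAt (fun y => gradient Φ y j)
      ((EuclideanSpace.proj j : Euc d →L[ℝ] ℝ).comp (fderiv ℝ (gradient Φ) x)) x :=
    (EuclideanSpace.proj j : Euc d →L[ℝ] ℝ).hasFDerivAt.comp x
      (differentiable_gradient hΦ x).hasFDerivAt
  have h2 : HasFDerivAt (fderiv ℝ Φ) (fderiv ℝ (fderiv ℝ Φ) x) x :=
    ((hΦ.fderiv_right (m := 1) (by norm_num)).differentiable
      (by norm_num)).differentiableAt.hasFDerivAt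
  have h3 := h2.clm_apply (hasFDerivAt_const (EuclideanSpace.single j (1 : ℝ)) x)
  simp_rw [gradient_apply] at h1
  have := congrArg (fun T => T v) (h1.unique h3)
  simpa using this

theorem det_fderiv_gradient {Φ : Euc d → ℝ} (hΦ : ContDiff ℝ (2 : ℕ) Φ) (x : Euc d) :
    (fderiv ℝ (gradient Φ) x).det = (Hess Φ x).det := by
  rw [ContinuousLinearMap.det,
    ← LinearMap.det_toMatrix (EuclideanSpace.basisFun (Fin d) ℝ).toBasis, ← Matrix.det_transpose]
  congr 1
  ext i j
  rw [Matrix.transpose_apply, LinearMap.toMatrix_apply]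
  simp [Hess, iteratedFDeriv_two_apply, fderiv_gradient_apply hΦ]

theorem stationary_phase_unit_scale (d : ℕ) (hd : 1 ≤ d) :
    ∃ C : ℝ, 0 < C ∧ ∀ (R : ℝ) (Φ : Euc d → ℝ) (ψ : Euc d → ℂ) (A L : ℝ),
      0 < R →
      ContDiff ℝ (d + 2 : ℕ) Φ →
      (∀ j, 2 ≤ j → j ≤ d + 2 → ∀ x ∈ ball (0 : Euc d) R, ‖iteratedFDeriv ℝ j Φ x‖ ≤ 1) →
      IsSymbol (ball 0 R) (d + 1) A (fun _ => 1) ψ →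
      Function.support ψ ⊆ ball 0 R →
      Set.InjOn (gradient Φ) (ball 0 R) →
      0 < L →
      (∀ x ∈ ball (0 : Euc d) R, L ≤ |(Hess Φ x).det|) →
      ‖∫ x, Complex.exp (Complex.I * Φ x) * ψ x‖ ≤ C / L * A := by
  obtain ⟨C, hC, hT⟩ := exists_isSymbol_iterate_transposeOp d (d + 1) 0
  set h : Euc d → ℝ := fun y => (1 + ‖y‖ ^ 2) ^ (-((d + 1 : ℕ) : ℝ) / 2) with hh
  have hint : Integrable h := by
    refine integrable_rpow_neg_one_add_norm_sq ?_
    simp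
  have hnn : ∀ y, 0 ≤ h y := fun y => by positivity
  have hJ : 0 ≤ ∫ y, h y := integral_nonneg hnn
  refine ⟨C * (∫ y, h y) + 1, by positivity, ?_⟩
  intro R Φ ψ A L hR hΦ hb hψ hsupp hinj hL hdet
  have : Nonempty (Fin d) := ⟨⟨0, hd⟩⟩
  have hts : tsupport ψ ⊆ closedBall 0 R := (closure_mono hsupp).trans closure_ball_subset_closedBall
  have hcs : HasCompactSupport ψ :=
    (isCompact_closedBall _ _).of_isClosed_subset (isClosed_tsupport _) hts
  rw [← zero_add (d + 1)] at hψ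
  obtain ⟨hsym, hsupp', hI⟩ := hT (ball 0 R) Φ (by convert hΦ using 2; omega)
    (fun j h2 hj => hb j h2 (by omega)) A ψ hψ hcs
  have hA : 0 ≤ A := by
    have := (norm_nonneg _).trans (hψ.bound 0 (Nat.zero_le _) 0 (mem_ball_self hR))
    simpa using this
  have hΦ2 : ContDiff ℝ (2 : ℕ) Φ := hΦ.of_le (by exact_mod_cast (by omega : 2 ≤ d + 2))
  set g := (transposeOp Φ)^[d + 1] ψ with hg
  have hder : ∀ x ∈ ball (0 : Euc d) R,
      HasFDerivWithinAt (gradient Φ) (fderiv ℝ (gradient Φ) x) (ball 0 R) x := fun x _ =>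
    (differentiable_gradient hΦ2 x).hasFDerivAt.hasFDerivWithinAt
  have hcv := integral_image_eq_integral_abs_det_fderiv_smul volume measurableSet_ball hder hinj h
  have hci := (integrableOn_image_iff_integrableOn_abs_det_fderiv_smul volume measurableSet_ball
    hder hinj h).mp hint.integrableOn
  have hset : ∫ x, Complex.exp (Complex.I * Φ x) * g x
      = ∫ x in ball 0 R, Complex.exp (Complex.I * Φ x) * g x := by
    rw [← setIntegral_eq_integral_of_forall_compl_eq_zero (s := closedBall 0 R)]
    · refine setIntegral_congr_set ?_
      rw [← ball_union_sphere]
      exact union_ae_eq_left_of_ae_eq_empty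
        (ae_eq_empty.mpr (Measure.addHaar_sphere volume (0 : Euc d) R))
    · intro x hx
      rw [image_eq_zero_of_notMem_tsupport fun hm => hx (hts (hsupp' hm)), mul_zero]
  have hpt : ∀ x ∈ ball (0 : Euc d) R, ‖Complex.exp (Complex.I * Φ x) * g x‖
      ≤ C * A / L * (|(fderiv ℝ (gradient Φ) x).det| • h (gradient Φ x)) := by
    intro x hx
    have h1 := hsym.bound 0 le_rfl x hx
    rw [norm_iteratedFDeriv_zero] at h1
    have h2 : (√(gradWeight Φ x))⁻¹ ^ (d + 1) = h (gradient Φ x) := by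
      rw [hh, gradWeight_eq, Real.sqrt_eq_rpow, ← Real.rpow_neg (by positivity),
        ← Real.rpow_natCast, ← Real.rpow_mul (by positivity)]
      congr 1
      ring
    rw [norm_mul, mul_comm Complex.I, Complex.norm_exp_ofReal_mul_I, one_mul, det_fderiv_gradient hΦ2,
      smul_eq_mul]
    rw [h2] at h1
    refine h1.trans ?_
    calc C * A * h (gradient Φ x) = C * A / L * (L * h (gradient Φ x)) := by field_simp
      _ ≤ _ := by
        have := hdet x hx
        have := hnn (gradient Φ x)
        gcongr
  rw [← hI, hset]
  calc ‖∫ x in ball 0 R, Complex.exp (Complex.I * Φ x) * g x‖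
      ≤ ∫ x in ball 0 R, C * A / L * (|(fderiv ℝ (gradient Φ) x).det| • h (gradient Φ x)) :=
        norm_integral_le_of_norm_le (hci.const_mul _)
          ((ae_restrict_iff' measurableSet_ball).mpr (Filter.Eventually.of_forall hpt))
    _ = C * A / L * ∫ y in gradient Φ '' ball 0 R, h y := by rw [integral_const_mul, hcv]
    _ ≤ C * A / L * ∫ y, h y := by
        exact mul_le_mul_of_nonneg_left
          (setIntegral_le_integral hint (Filter.Eventually.of_forall hnn)) (by positivity)
    _ = C * (∫ y, h y) / L * A := by ring
    _ ≤ (C * (∫ y, h y) + 1) / L * A := by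
        gcongr
        exact le_add_of_nonneg_right zero_le_one

end StationaryPhase

section Scaling

variable {d : ℕ} {F : Type*} [NormedAddCommGroup F] [NormedSpace ℝ F]

theorem supDeriv_nonneg (j : ℕ) (f : Euc d → F) (s : Set (Euc d)) : 0 ≤ supDeriv j f s :=
  Real.sSup_nonneg fun _ ⟨_, _, h⟩ => h ▸ norm_nonneg _

theorem norm_iteratedFDeriv_le_supDeriv {f : Euc d → F} {n j : ℕ} (hf : ContDiff ℝ n f)
    (hj : j ≤ n) {x : Euc d} (hx : x ∈ ball (0 : Euc d) 1) :
    ‖iteratedFDeriv ℝ j f x‖ ≤ supDeriv j f (ball 0 1) := by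
  have hc : Continuous fun x => ‖iteratedFDeriv ℝ j f x‖ :=
    (hf.continuous_iteratedFDeriv (by exact_mod_cast hj)).norm
  exact le_csSup (((isCompact_closedBall (0 : Euc d) 1).image hc).bddAbove.mono
    (image_mono ball_subset_closedBall)) (mem_image_of_mem _ hx)

theorem Hess_const_mul_comp_smul {Φ : Euc d → ℝ} (hΦ : ContDiff ℝ (2 : ℕ) Φ) (a c : ℝ)
    (y : Euc d) : Hess (fun y => a * Φ (c • y)) y = (a * c ^ 2) • Hess Φ (c • y) := by
  ext i j
  have h1 := iteratedFDeriv_const_smul_apply (𝕜 := ℝ) (a := a) (i := 2) (x := y)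
    (f := fun y => Φ (c • y)) (hΦ.comp (contDiff_const_smul c)).contDiffAt
  rw [iteratedFDeriv_comp_const_smul c hΦ] at h1
  have h2 : iteratedFDeriv ℝ 2 (fun y => a * Φ (c • y)) y
      = a • c ^ 2 • iteratedFDeriv ℝ 2 Φ (c • y) := h1
  simp only [Hess, Matrix.of_apply, Matrix.smul_apply, h2]
  simp [mul_assoc]

theorem gradient_const_mul_comp_smul {Φ : Euc d → ℝ} (hΦ : Differentiable ℝ Φ) (a c : ℝ)
    (y : Euc d) : gradient (fun y => a * Φ (c • y)) y = (a * c) • gradient Φ (c • y) := by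
  ext j
  have h : HasFDerivAt (fun y => a * Φ (c • y))
      (a • (fderiv ℝ Φ (c • y)).comp (c • ContinuousLinearMap.id ℝ (Euc d))) y :=
    ((hΦ (c • y)).hasFDerivAt.comp y ((hasFDerivAt_id y).const_smul c)).const_mul a
  rw [PiLp.smul_apply, gradient_apply, gradient_apply, partialDeriv, h.fderiv]
  simp [partialDeriv, mul_assoc]

end Scaling

/-- Alazard–Burq–Zuily uniform stationary phase estimate. -/
theorem stmt0 (d : ℕ) (hd : 1 ≤ d) :
    ∃ C : ℝ, 0 < C ∧
      ∀ (lam : ℝ) (Φ : Euc d → ℝ) (ψ : Euc d → ℂ),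
        1 ≤ lam →
        ContDiff ℝ (d + 2 : ℕ) Φ →
        ContDiff ℝ (d + 1 : ℕ) ψ →
        Function.support ψ ⊆ ball 0 1 →
        Set.InjOn (gradient Φ) (ball 0 1) →
        0 < LStar Φ (ball 0 1) →
        ‖oscInt lam Φ ψ‖ ≤
          C / LStar Φ (ball 0 1) *
            (1 + Pnorm (d + 2) Φ (ball 0 1) ^ ((d : ℝ) / 2)) *
            CnormNat (d + 1) ψ (ball 0 1) * lam ^ (-(d : ℝ) / 2) := by
  obtain ⟨C, hC, hmain⟩ := stationary_phase_unit_scale d hd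
  refine ⟨C, hC, ?_⟩
  intro lam Φ ψ hlam hΦ hψ hsupp hinj hL
  set L := LStar Φ (ball 0 1) with hLdef
  set P := Pnorm (d + 2) Φ (ball 0 1) with hP
  set A := CnormNat (d + 1) ψ (ball 0 1) with hA
  have hΦ2 : ContDiff ℝ (2 : ℕ) Φ := hΦ.of_le (by exact_mod_cast (by omega : 2 ≤ d + 2))
  have hP0 : 0 ≤ P := Finset.sum_nonneg fun j _ => supDeriv_nonneg j Φ _
  have hA0 : 0 ≤ A := Finset.sum_nonneg fun j _ => supDeriv_nonneg j ψ _
  set q := max 1 P with hq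
  have hq1 : 1 ≤ q := le_max_left _ _
  have hq0 : 0 < q := one_pos.trans_le hq1
  have hlam0 : 0 < lam := one_pos.trans_le hlam
  have hμ1 : 1 ≤ lam * q := one_le_mul_of_one_le_of_one_le hlam hq1
  have hμ0 : 0 < lam * q := one_pos.trans_le hμ1
  set R := √(lam * q) with hR
  have hR1 : 1 ≤ R := Real.one_le_sqrt.mpr hμ1
  have hR0 : 0 < R := one_pos.trans_le hR1
  set c := R⁻¹ with hc
  have hc0 : 0 < c := inv_pos.mpr hR0
  have hc1 : c ≤ 1 := inv_le_one_of_one_le₀ hR1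
  have hc2 : lam * c ^ 2 = q⁻¹ := by
    rw [hc, inv_pow, hR, Real.sq_sqrt hμ0.le]
    field_simp
  have hball : ∀ y ∈ ball (0 : Euc d) R, c • y ∈ ball (0 : Euc d) 1 := by
    intro y hy
    rw [mem_ball_zero_iff] at hy ⊢
    rw [norm_smul, Real.norm_of_nonneg hc0.le, hc, inv_mul_lt_one₀ hR0]
    exact hy
  have key := hmain R (fun y => lam * Φ (c • y)) (fun y => ψ (c • y)) A ((q⁻¹) ^ d * L) hR0
    (contDiff_const.mul (hΦ.comp (contDiff_const_smul c))) ?_ ?_ ?_ ?_ (by positivity) ?_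
  · have hscale : ∫ y, Complex.exp (Complex.I * ((lam * Φ (c • y) : ℝ) : ℂ)) * ψ (c • y)
        = |(c ^ d)⁻¹| • oscInt lam Φ ψ := by
      have := Measure.integral_comp_smul volume
        (fun x : Euc d => Complex.exp (Complex.I * (lam : ℂ) * (Φ x : ℂ)) * ψ x) c
      rw [finrank_euclideanSpace_fin] at this
      rw [oscInt, ← this]
      simp only [Complex.ofReal_mul, mul_assoc]
    rw [hscale, norm_smul, Real.norm_eq_abs, abs_abs, abs_of_pos (by positivity),
      inv_mul_le_iff₀ (by positivity)] at key
    have hcd : c ^ d * q ^ d = lam ^ (-(d : ℝ) / 2) * q ^ ((d : ℝ) / 2) := by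
      have h1 : c ^ d = (lam * q) ^ (-(d : ℝ) / 2) := by
        rw [hc, hR, Real.sqrt_eq_rpow, ← Real.rpow_neg hμ0.le, ← Real.rpow_natCast,
          ← Real.rpow_mul hμ0.le]
        congr 1
        ring
      rw [h1, Real.mul_rpow hlam0.le hq0.le, mul_assoc, ← Real.rpow_natCast q d,
        ← Real.rpow_add hq0]
      congr 2
      ring
    have hqP : q ^ ((d : ℝ) / 2) ≤ 1 + P ^ ((d : ℝ) / 2) := by
      have := Real.rpow_nonneg hP0 ((d : ℝ) / 2)
      rcases max_choice 1 P with h | h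
      · rw [hq, h, Real.one_rpow]
        linarith
      · rw [hq, h]
        linarith
    calc ‖oscInt lam Φ ψ‖ ≤ c ^ d * (C / (q⁻¹ ^ d * L) * A) := key
      _ = C / L * A * (c ^ d * q ^ d) := by
        rw [inv_pow q d]
        field_simp
      _ = C / L * q ^ ((d : ℝ) / 2) * A * lam ^ (-(d : ℝ) / 2) := by rw [hcd]; ring
      _ ≤ _ := by gcongr
  · intro j hj2 hj y hy
    have hj' : ContDiff ℝ (j : ℕ) Φ := hΦ.of_le (by exact_mod_cast hj)
    have h1 := iteratedFDeriv_const_smul_apply (𝕜 := ℝ) (a := lam) (i := j) (x := y)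
      (f := fun y => Φ (c • y)) (hj'.comp (contDiff_const_smul c)).contDiffAt
    rw [iteratedFDeriv_comp_const_smul c hj'] at h1
    have h2 : iteratedFDeriv ℝ j (fun y => lam * Φ (c • y)) y
        = lam • c ^ j • iteratedFDeriv ℝ j Φ (c • y) := h1
    rw [h2, norm_smul, norm_smul, Real.norm_of_nonneg hlam0.le,
      Real.norm_of_nonneg (by positivity)]
    have h3 : ‖iteratedFDeriv ℝ j Φ (c • y)‖ ≤ q :=
      (norm_iteratedFDeriv_le_supDeriv hΦ hj (hball y hy)).trans
        ((Finset.single_le_sum (f := fun j => supDeriv j Φ (ball 0 1))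
          (fun j _ => supDeriv_nonneg j Φ _) (Finset.mem_Icc.mpr ⟨hj2, hj⟩)).trans
          (le_max_right _ _))
    calc lam * (c ^ j * ‖iteratedFDeriv ℝ j Φ (c • y)‖) ≤ lam * (c ^ 2 * q) := by
          have := pow_le_pow_of_le_one hc0.le hc1 hj2
          gcongr
      _ = 1 := by rw [← mul_assoc, hc2, inv_mul_cancel₀ hq0.ne']
  · refine ⟨hψ.comp (contDiff_const_smul c), fun j hj y hy => ?_⟩
    have hj' : ContDiff ℝ (j : ℕ) ψ := hψ.of_le (by exact_mod_cast hj)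
    rw [iteratedFDeriv_comp_const_smul c hj', norm_smul, Real.norm_of_nonneg (by positivity),
      mul_one]
    refine (mul_le_of_le_one_left (norm_nonneg _) (pow_le_one₀ hc0.le hc1)).trans ?_
    exact (norm_iteratedFDeriv_le_supDeriv hψ hj (hball y hy)).trans
      (Finset.single_le_sum (f := fun j => supDeriv j ψ (ball 0 1))
        (fun j _ => supDeriv_nonneg j ψ _) (Finset.mem_range.mpr (by omega)))
  · intro y hy
    have h := hsupp (show c • y ∈ Function.support ψ from hy)
    rw [mem_ball_zero_iff, norm_smul, Real.norm_of_nonneg hc0.le, hc, inv_mul_lt_one₀ hR0] at h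
    exact mem_ball_zero_iff.mpr h
  · intro y hy z hz hyz
    have hd1 : Differentiable ℝ Φ := hΦ2.differentiable (by norm_num)
    rw [gradient_const_mul_comp_smul hd1, gradient_const_mul_comp_smul hd1] at hyz
    exact smul_right_injective _ hc0.ne' (hinj (hball y hy) (hball z hz)
      (smul_right_injective _ (mul_pos hlam0 hc0).ne' hyz))
  · intro y hy
    rw [Hess_const_mul_comp_smul hΦ2, Matrix.det_smul, Fintype.card_fin, hc2, abs_mul,
      abs_of_pos (by positivity)]
    gcongr
    exact csInf_le ⟨0, fun _ ⟨_, _, h⟩ => h ▸ abs_nonneg _⟩ (mem_image_of_mem _ (hball y hy))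

end
end

section
/- Let d ≥ 1 and let φ be a smooth nonnegative function on ℝ^d, not identically zero, supported in B(0,1). Define Φ_λ(x) = |x|² and ψ_λ(x) = Σ_{ν ∈ λ^{-1}ℤ^d ∩ B(0,1/2)} φ(2λ(x − ν)) e^{−iλ|ν|²}. Then: (i) each term I_{λ,ν} := ∫ e^{iλ(|x|² − |ν|²)} φ(2λ(x − ν)) dx satisfies Re(I_{λ,ν}) ≥ c λ^{-d} for a constant c > 0 depending only on φ and d; and (ii) there is a constant c' > 0 depending only on φ and d such that |∫_{ℝ^d} e^{iλΦ_λ(x)} ψ_λ(x) dx| ≥ c' for all λ ≥ 1. In particular, no decay in λ is possible when the amplitude satisfies the growth condition |D^γ ψ_λ| ≲ λ^{|γ|} (i.e. the condition with β = 1). -/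
open MeasureTheory Metric Set

noncomputable section

/-- Reinterpret a plain function `Fin d → ℝ` as a point of Euclidean space. -/
noncomputable def toEuc {d : ℕ} (v : Fin d → ℝ) : Euc d :=
  (EuclideanSpace.equiv (Fin d) ℝ).symm v

theorem hasCompactSupport_of_support_subset_ball {d : ℕ} {φ : Euc d → ℝ}
    (hφsupp : Function.support φ ⊆ ball 0 1) : HasCompactSupport φ :=
  HasCompactSupport.of_support_subset_isCompact (isCompact_closedBall 0 1)
    (hφsupp.trans ball_subset_closedBall)

theorem integral_dilate_translate {d : ℕ} (φ : Euc d → ℝ) {lam : ℝ} (hlam : 0 < lam) (v : Euc d) :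
    ∫ x, φ ((2 * lam) • (x - v)) = ((2 : ℝ) ^ d)⁻¹ * lam ^ (-(d : ℝ)) * ∫ x, φ x := by
  rw [integral_sub_right_eq_self (fun x => φ ((2 * lam) • x)) v,
    Measure.integral_comp_smul, finrank_euclideanSpace, Fintype.card_fin,
    abs_of_nonneg (by positivity), smul_eq_mul, Real.rpow_neg hlam.le, Real.rpow_natCast,
    mul_pow, mul_inv]

theorem integrable_dilate_translate {d : ℕ} {φ : Euc d → ℝ} (hφ : Continuous φ)
    (hc : HasCompactSupport φ) {lam : ℝ} (hlam : 0 < lam) (v : Euc d) :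
    Integrable (fun x => φ ((2 * lam) • (x - v))) :=
  ((hφ.integrable_of_hasCompactSupport hc).comp_smul (by positivity)).comp_sub_right v

theorem abs_phase_le {E : Type*} [NormedAddCommGroup E] {lam : ℝ}
    (hlam : 1 ≤ lam) {x v : E} (hv : ‖v‖ < 1 / 2) (hx : ‖x - v‖ < 1 / (2 * lam)) :
    |lam * (‖x‖ ^ 2 - ‖v‖ ^ 2)| ≤ 3 / 4 := by
  have h0 : 0 < lam := by linarith
  have h1 : |‖x‖ - ‖v‖| ≤ ‖x - v‖ := abs_norm_sub_norm_le x v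
  have h2 : ‖x - v‖ * lam ≤ 1 / 2 := by
    rw [lt_div_iff₀ (by positivity)] at hx
    linarith
  have h3 : ‖x - v‖ ≤ 1 / 2 := by nlinarith [norm_nonneg (x - v)]
  have h4 : ‖x‖ + ‖v‖ ≤ 3 / 2 := by linarith [(abs_le.1 h1).2]
  have h5 : lam * (‖x‖ ^ 2 - ‖v‖ ^ 2) = ((‖x‖ - ‖v‖) * lam) * (‖x‖ + ‖v‖) := by ring
  rw [h5, abs_mul, abs_mul, abs_of_pos h0, abs_of_nonneg (by positivity : 0 ≤ ‖x‖ + ‖v‖)]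
  have h6 : |‖x‖ - ‖v‖| * lam ≤ 1 / 2 := (mul_le_mul_of_nonneg_right h1 h0.le).trans h2
  calc _ ≤ 1 / 2 * (3 / 2 : ℝ) := mul_le_mul h6 h4 (by positivity) (by norm_num)
    _ = 3 / 4 := by norm_num

/-- The integrand of a single wave packet centred at `v`. -/
def wavePacket {d : ℕ} (φ : Euc d → ℝ) (lam : ℝ) (v x : Euc d) : ℂ :=
  Complex.exp (Complex.I * (lam : ℂ) * ((‖x‖ ^ 2 - ‖v‖ ^ 2 : ℝ) : ℂ)) *
    ((φ ((2 * lam) • (x - v)) : ℝ) : ℂ)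

theorem re_wavePacket {d : ℕ} (φ : Euc d → ℝ) (lam : ℝ) (v x : Euc d) :
    (wavePacket φ lam v x).re =
      Real.cos (lam * (‖x‖ ^ 2 - ‖v‖ ^ 2)) * φ ((2 * lam) • (x - v)) := by
  have h : Complex.I * (lam : ℂ) * ((‖x‖ ^ 2 - ‖v‖ ^ 2 : ℝ) : ℂ) =
      ((lam * (‖x‖ ^ 2 - ‖v‖ ^ 2) : ℝ) : ℂ) * Complex.I := by push_cast; ring
  rw [wavePacket, h, Complex.re_mul_ofReal, Complex.exp_ofReal_mul_I_re]

theorem integrable_wavePacket {d : ℕ} {φ : Euc d → ℝ} (hφ : Continuous φ)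
    (hc : HasCompactSupport φ) {lam : ℝ} (hlam : 0 < lam) (v : Euc d) :
    Integrable (wavePacket φ lam v) := by
  have hi := (integrable_dilate_translate hφ hc hlam v).ofReal (𝕜 := ℂ)
  refine hi.mono ?_ (.of_forall fun x => ?_)
  · refine Continuous.aestronglyMeasurable ?_
    unfold wavePacket
    fun_prop
  · have h : Complex.I * (lam : ℂ) * ((‖x‖ ^ 2 - ‖v‖ ^ 2 : ℝ) : ℂ) =
        ((lam * (‖x‖ ^ 2 - ‖v‖ ^ 2) : ℝ) : ℂ) * Complex.I := by push_cast; ring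
    rw [wavePacket, h, norm_mul, Complex.norm_exp_ofReal_mul_I, one_mul]
    rfl

theorem le_re_integral_wavePacket {d : ℕ} {φ : Euc d → ℝ} (hφ : Continuous φ)
    (hφ0 : ∀ x, 0 ≤ φ x) (hφsupp : Function.support φ ⊆ ball 0 1) {lam : ℝ} (hlam : 1 ≤ lam)
    {v : Euc d} (hv : ‖v‖ < 1 / 2) :
    (1 / 2 * ((2 : ℝ) ^ d)⁻¹ * ∫ x, φ x) * lam ^ (-(d : ℝ)) ≤
      (∫ x, wavePacket φ lam v x).re := by
  have h0 : 0 < lam := by linarith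
  have hc := hasCompactSupport_of_support_subset_ball hφsupp
  have hw := integrable_wavePacket hφ hc h0 v
  have hre : (∫ x, wavePacket φ lam v x).re = ∫ x, (wavePacket φ lam v x).re :=
    (Complex.reCLM.integral_comp_comm hw).symm
  have hlhs : (1 / 2 * ((2 : ℝ) ^ d)⁻¹ * ∫ x, φ x) * lam ^ (-(d : ℝ)) =
      ∫ x, 1 / 2 * φ ((2 * lam) • (x - v)) := by
    rw [integral_const_mul, integral_dilate_translate φ h0 v]
    ring
  rw [hre, hlhs]
  refine integral_mono ((integrable_dilate_translate hφ hc h0 v).const_mul _)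
    hw.re fun x => ?_
  change _ ≤ (wavePacket φ lam v x).re
  rw [re_wavePacket]
  by_cases hx : φ ((2 * lam) • (x - v)) = 0
  · simp [hx]
  · refine mul_le_mul_of_nonneg_right ?_ (hφ0 _)
    have hb : ‖(2 * lam) • (x - v)‖ < 1 := by simpa using hφsupp hx
    rw [norm_smul, Real.norm_of_nonneg (by positivity)] at hb
    have hx' : ‖x - v‖ < 1 / (2 * lam) := by
      rw [lt_div_iff₀ (by positivity)]
      linarith
    have hp := abs_phase_le hlam hv hx'
    have hcos := Real.one_sub_sq_div_two_le_cos (x := lam * (‖x‖ ^ 2 - ‖v‖ ^ 2))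
    nlinarith [abs_le.1 hp]

theorem toEuc_norm_sq {d : ℕ} (v : Fin d → ℝ) : ‖toEuc v‖ ^ 2 = ∑ i, v i ^ 2 := by
  rw [EuclideanSpace.norm_sq_eq]
  simp [toEuc]

theorem finite_lattice_ball {d : ℕ} {lam : ℝ} (hlam : 0 < lam) :
    {m : Fin d → ℤ | ‖toEuc (fun i => (m i : ℝ) / lam)‖ < 1 / 2}.Finite := by
  refine (Set.finite_Icc (fun _ : Fin d => -⌈lam⌉) (fun _ => ⌈lam⌉)).subset fun m hm => ?_
  have key : ∀ i, |(m i : ℝ)| ≤ ⌈lam⌉ := fun i => by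
    have h1 : ‖toEuc (fun i => (m i : ℝ) / lam) i‖ ≤ _ := PiLp.norm_apply_le _ i
    have h2 : |(m i : ℝ) / lam| < 1 / 2 := h1.trans_lt hm
    rw [abs_div, abs_of_pos hlam, div_lt_iff₀ hlam] at h2
    linarith [Int.le_ceil lam]
  refine ⟨fun i => ?_, fun i => ?_⟩
  · exact_mod_cast (abs_le.1 (key i)).1
  · exact_mod_cast (abs_le.1 (key i)).2

theorem le_card_lattice_ball {d : ℕ} (hd : 1 ≤ d) {lam : ℝ} (hlam : 0 < lam) :
    (lam / (4 * d)) ^ d ≤ ((finite_lattice_ball (d := d) hlam).toFinset.card : ℝ) := by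
  have hd' : (1 : ℝ) ≤ d := by exact_mod_cast hd
  set K : ℤ := ⌊lam / (4 * d)⌋ with hK
  have hq : 0 ≤ lam / (4 * d) := by positivity
  have hK0 : 0 ≤ K := Int.floor_nonneg.2 hq
  have hKle : (K : ℝ) ≤ lam / (4 * d) := Int.floor_le _
  have hsub : Fintype.piFinset (fun _ : Fin d => Finset.Icc (0 : ℤ) K) ⊆
      (finite_lattice_ball (d := d) hlam).toFinset := by
    intro m hm
    simp only [Fintype.mem_piFinset, Finset.mem_Icc] at hm
    simp only [Set.Finite.mem_toFinset, Set.mem_ofPred_eq]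
    refine lt_of_pow_lt_pow_left₀ 2 (by norm_num) ?_
    rw [toEuc_norm_sq]
    have hterm : ∀ i, ((m i : ℝ) / lam) ^ 2 ≤ (1 / (4 * d)) ^ 2 := fun i => by
      have h0 : (0 : ℝ) ≤ m i := by exact_mod_cast (hm i).1
      have h1 : (m i : ℝ) ≤ K := by exact_mod_cast (hm i).2
      refine pow_le_pow_left₀ (by positivity) ?_ 2
      rw [div_le_iff₀ hlam, one_div_mul_eq_div]
      exact h1.trans hKle
    calc ∑ i, ((m i : ℝ) / lam) ^ 2 ≤ ∑ _i : Fin d, (1 / (4 * d : ℝ)) ^ 2 :=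
          Finset.sum_le_sum fun i _ => hterm i
      _ = 1 / (16 * d) := by
          rw [Finset.sum_const, Finset.card_univ, Fintype.card_fin, nsmul_eq_mul]
          field_simp
          norm_num
      _ < (1 / 2) ^ 2 := by
          rw [div_lt_iff₀ (by positivity)]
          linarith
  refine le_trans ?_ (Nat.cast_le.2 (Finset.card_le_card hsub))
  rw [Fintype.card_piFinset_const, Int.card_Icc, Nat.cast_pow]
  refine pow_le_pow_left₀ hq ?_ _
  have h2 : (((K + 1 - 0).toNat : ℤ) : ℝ) = K + 1 := by
    rw [Int.toNat_of_nonneg (by omega)]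
    push_cast
    ring
  rw [Int.cast_natCast] at h2
  rw [h2]
  exact (Int.lt_floor_add_one _).le

theorem oscInt_eq_sum_integral_wavePacket {d : ℕ} {φ : Euc d → ℝ} (hφ : Continuous φ)
    (hc : HasCompactSupport φ) {lam : ℝ} (hlam : 0 < lam) :
    oscInt lam (fun x => ‖x‖ ^ 2)
      (fun x => ∑' m : Fin d → ℤ,
        if ‖toEuc (fun i => (m i : ℝ) / lam)‖ < 1 / 2 then
          ((φ ((2 * lam) • (x - toEuc (fun i => (m i : ℝ) / lam))) : ℝ) : ℂ) *
            Complex.exp (-Complex.I * (lam : ℂ) *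
              ((‖toEuc (fun i => (m i : ℝ) / lam)‖ ^ 2 : ℝ) : ℂ))
        else 0) =
    ∑ m ∈ (finite_lattice_ball (d := d) hlam).toFinset,
      ∫ x, wavePacket φ lam (toEuc (fun i => (m i : ℝ) / lam)) x := by
  rw [oscInt, ← integral_finsetSum _ fun m _ => integrable_wavePacket hφ hc hlam _]
  congr 1
  funext x
  rw [tsum_eq_sum (s := (finite_lattice_ball (d := d) hlam).toFinset), Finset.mul_sum]
  · refine Finset.sum_congr rfl fun m hm => ?_
    rw [Set.Finite.mem_toFinset, Set.mem_ofPred_eq] at hm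
    rw [if_pos hm, wavePacket, mul_left_comm, ← Complex.exp_add, mul_comm]
    congr 2
    push_cast
    ring
  · intro m hm
    rw [Set.Finite.mem_toFinset, Set.mem_ofPred_eq] at hm
    exact if_neg hm

/-- Remark 3: with `Φ_λ(x) = |x|²` and the amplitude
`ψ_λ(x) = Σ_{ν ∈ λ⁻¹ℤ^d ∩ B(0,1/2)} φ(2λ(x − ν)) e^{−iλ|ν|²}`, each piece
`I_{λ,ν}` has real part `≳ λ^{-d}` and the whole oscillatory integral has no decay in `λ`. -/
theorem stmt5 (d : ℕ) (hd : 1 ≤ d) (φ : Euc d → ℝ)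
    (hφ : ContDiff ℝ (⊤ : ℕ∞) φ) (hφ0 : ∀ x, 0 ≤ φ x) (hφne : φ ≠ 0)
    (hφsupp : Function.support φ ⊆ ball 0 1) :
    ∃ c : ℝ, 0 < c ∧ ∃ c' : ℝ, 0 < c' ∧
      ∀ lam : ℝ, 1 ≤ lam →
        -- (i) each wave packet contributes `Re(I_{λ,ν}) ≥ c λ^{-d}`:
        (∀ m : Fin d → ℤ, ‖toEuc (fun i => (m i : ℝ) / lam)‖ < 1 / 2 →
          c * lam ^ (-(d : ℝ)) ≤
            (∫ x : Euc d,
              Complex.exp (Complex.I * (lam : ℂ) *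
                ((‖x‖ ^ 2 - ‖toEuc (fun i => (m i : ℝ) / lam)‖ ^ 2 : ℝ) : ℂ)) *
                ((φ ((2 * lam) • (x - toEuc (fun i => (m i : ℝ) / lam))) : ℝ) : ℂ)).re) ∧
        -- (ii) the full oscillatory integral has size bounded below:
        c' ≤ ‖oscInt lam (fun x => ‖x‖ ^ 2)
            (fun x => ∑' m : Fin d → ℤ,
              if ‖toEuc (fun i => (m i : ℝ) / lam)‖ < 1 / 2 then
                ((φ ((2 * lam) • (x - toEuc (fun i => (m i : ℝ) / lam))) : ℝ) : ℂ) *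
                  Complex.exp (-Complex.I * (lam : ℂ) *
                    ((‖toEuc (fun i => (m i : ℝ) / lam)‖ ^ 2 : ℝ) : ℂ))
              else 0)‖ := by
  have hcont : Continuous φ := hφ.continuous
  have hcs := hasCompactSupport_of_support_subset_ball hφsupp
  have hint : 0 < ∫ x, φ x := by
    obtain ⟨x, hx⟩ := Function.ne_iff.1 hφne
    exact hcont.integral_pos_of_hasCompactSupport_nonneg_nonzero hcs hφ0 hx
  have hd0 : (0 : ℝ) < d := by exact_mod_cast hd
  refine ⟨1 / 2 * ((2 : ℝ) ^ d)⁻¹ * ∫ x, φ x, by positivity,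
    (1 / 2 * ((2 : ℝ) ^ d)⁻¹ * ∫ x, φ x) * (1 / (4 * d)) ^ d, by positivity,
    fun lam hlam => ?_⟩
  have h0 : 0 < lam := by linarith
  refine ⟨fun m hm => le_re_integral_wavePacket hcont hφ0 hφsupp hlam hm, ?_⟩
  rw [oscInt_eq_sum_integral_wavePacket hcont hcs h0]
  refine le_trans ?_ (Complex.re_le_norm _)
  rw [Complex.re_sum]
  have hpacket : ∀ m ∈ (finite_lattice_ball (d := d) h0).toFinset, _ := fun m hm =>
    le_re_integral_wavePacket hcont hφ0 hφsupp hlam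
      (v := toEuc (fun i => (m i : ℝ) / lam)) (by simpa using hm)
  refine le_trans ?_ (Finset.card_nsmul_le_sum _ _ _ hpacket)
  set C := 1 / 2 * ((2 : ℝ) ^ d)⁻¹ * ∫ x, φ x
  have hC : 0 < C := by positivity
  have hL : 0 < lam ^ (-(d : ℝ)) := by positivity
  calc C * (1 / (4 * d)) ^ d = (lam / (4 * d)) ^ d * (C * lam ^ (-(d : ℝ))) := by
        rw [Real.rpow_neg h0.le, Real.rpow_natCast, div_pow, div_pow, one_pow]
        field_simp
    _ ≤ _ := by
        rw [nsmul_eq_mul]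
        exact mul_le_mul_of_nonneg_right (le_card_lattice_ball hd h0) (by positivity)

end
end
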